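/- arXiv:2405.16906 — 2 statements merged into one kernel-verified Lean document; each statement's English description precedes it below -/
import Mathlib

section
/- Let r > 0 and let S ⊆ X be a finite set such that the support X_Q of Q_X is contained in the union of the closed balls B(s, r/2) over s ∈ S. Then Δ_PMW(Q,Q;r) ≤ |S|. In particular, Δ_PMW(Q,Q;r) is at most the (r/2)-covering number of X_Q. -/
open MeasureTheory Metric ENNReal

/-- `Δ_PMW(Q,Q;r) = ∫ (Q_X(B(x,r)))⁻¹ dQ_X(x)`, with the convention `1/0 = ∞`. -/
noncomputable def deltaPMWself {X : Type*} [MetricSpace X] [MeasurableSpace X]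
    (QX : Measure X) (r : ℝ) : ℝ≥0∞ :=
  ∫⁻ x, (QX (closedBall x r))⁻¹ ∂QX

/-- The support `X_Q = {x : Q_X(B(x,r)) > 0 for all r > 0}` of a measure. -/
def msupport {X : Type*} [MetricSpace X] [MeasurableSpace X] (μ : Measure X) : Set X :=
  {x | ∀ r : ℝ, 0 < r → 0 < μ (closedBall x r)}

/-- The support of a measure on a compact metric space is conull. -/
lemma ae_mem_msupport {X : Type*} [MetricSpace X] [CompactSpace X] [MeasurableSpace X]
    (μ : Measure X) : ∀ᵐ x ∂μ, x ∈ msupport μ := by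
  filter_upwards [Measure.support_mem_ae (μ := μ)] with x hx ρ hρ
  exact (Measure.mem_support_iff_forall x).1 hx _ (closedBall_mem_nhds x hρ)

/-- If `S` is a finite set whose closed balls of radius `r/2`
cover the support `X_Q` of `Q_X`, then `Δ_PMW(Q,Q;r) ≤ |S|`; in particular
`Δ_PMW(Q,Q;r)` is bounded by the `(r/2)`-covering number of `X_Q`. -/
theorem statement5 {X : Type*} [MetricSpace X] [CompactSpace X]
    [MeasurableSpace X] [BorelSpace X]
    (QX : Measure X) [IsProbabilityMeasure QX]
    (r : ℝ) (hr : 0 < r) (S : Finset X)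
    (hcover : msupport QX ⊆ ⋃ s ∈ S, closedBall s (r / 2)) :
    deltaPMWself QX r ≤ (S.card : ℝ≥0∞) := by
  have hle : ∀ᵐ x ∂QX, (QX (closedBall x r))⁻¹ ≤
      ∑ s ∈ S, (closedBall s (r / 2)).indicator (fun _ ↦ (QX (closedBall s (r / 2)))⁻¹) x := by
    filter_upwards [ae_mem_msupport QX] with x hx
    obtain ⟨s, hs, hxs⟩ := Set.mem_iUnion₂.1 (hcover hx)
    calc (QX (closedBall x r))⁻¹
        ≤ (QX (closedBall s (r / 2)))⁻¹ := by
          refine ENNReal.inv_le_inv.2 (measure_mono (closedBall_subset_closedBall' ?_))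
          linarith [mem_closedBall'.1 hxs]
      _ = (closedBall s (r / 2)).indicator (fun _ ↦ (QX (closedBall s (r / 2)))⁻¹) x :=
          by rw [Set.indicator_of_mem hxs]
      _ ≤ _ := Finset.single_le_sum
          (f := fun s ↦ (closedBall s (r / 2)).indicator
            (fun _ ↦ (QX (closedBall s (r / 2)))⁻¹) x) (fun _ _ ↦ zero_le) hs
  calc deltaPMWself QX r
      ≤ ∫⁻ x, ∑ s ∈ S, (closedBall s (r / 2)).indicator
          (fun _ ↦ (QX (closedBall s (r / 2)))⁻¹) x ∂QX := lintegral_mono_ae hle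
    _ = ∑ s ∈ S, (QX (closedBall s (r / 2)))⁻¹ * QX (closedBall s (r / 2)) := by
        rw [lintegral_finsetSum _
          fun s _ ↦ measurable_const.indicator measurableSet_closedBall]
        simp_rw [lintegral_indicator_const measurableSet_closedBall]
    _ ≤ ∑ _s ∈ S, 1 := Finset.sum_le_sum fun _ _ ↦ ENNReal.inv_mul_le_one _
    _ = S.card := by simp
end

section
/- Let d : X × X → [0,∞) be a measurable function (no metric axioms required), and for t > 0 let B_d(x,t) = {z ∈ X : d(z,x) ≤ t} and Δ_d(P,Q;t) = ∫_X (P_X(B_d(x,t)))^{-1} dQ_X(x), Δ_d(Q,Q;t) = ∫_X (Q_X(B_d(x,t)))^{-1} dQ_X(x), with the convention 1/0 = ∞. Let m, n ≥ 1 and consider independent points Z_1,…,Z_m ~ P_X, W_1,…,W_n ~ Q_X and X ~ Q_X, i.e., the product measure P_X^m ⊗ Q_X^n ⊗ Q_X. Then the probability that min over all m+n sample points U ∈ {Z_1,…,Z_m,W_1,…,W_n} of d(U, X) exceeds t is at most min{ Δ_d(P,Q;t)/m , Δ_d(Q,Q;t)/n }. -/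
open MeasureTheory ENNReal

/-- `Δ_d(P,Q;t) = ∫ (P_X(B_d(x,t)))⁻¹ dQ_X(x)` where
`B_d(x,t) = {z : d(z,x) ≤ t}`, with the convention `1/0 = ∞`. -/
noncomputable def deltaGen {X : Type*} [MeasurableSpace X] (d : X × X → ℝ)
    (PX QX : Measure X) (t : ℝ) : ℝ≥0∞ :=
  ∫⁻ x, (PX {z | d (z, x) ≤ t})⁻¹ ∂QX

/-- If `p + q = 1`, then `q ^ k ≤ p⁻¹ / k`. -/
lemma pow_le_inv_div_of_add_eq_one {p q : ℝ≥0∞} (h : p + q = 1) (k : ℕ) :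
    q ^ k ≤ p⁻¹ / k := by
  have hp : p ≠ ∞ := ne_top_of_le_ne_top one_ne_top (h ▸ le_self_add)
  have hq : q ≠ ∞ := ne_top_of_le_ne_top one_ne_top (h ▸ le_add_self)
  lift p to NNReal using hp
  lift q to NNReal using hq
  rw [div_eq_mul_inv, ← ENNReal.mul_inv (Or.inr (natCast_ne_top k)) (Or.inl coe_ne_top),
    ENNReal.le_inv_iff_mul_le]
  norm_cast at h ⊢
  have h' : (p : ℝ) + q = 1 := mod_cast h
  have hp0 : (0 : ℝ) ≤ p := p.2
  have hq0 : (0 : ℝ) ≤ q := q.2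
  have bernoulli : 1 + (k : ℝ) * p ≤ (1 + (p : ℝ)) ^ k :=
    one_add_mul_le_pow (by linarith) k
  have key : (q : ℝ) ^ k * (p * k) ≤ 1 := calc
    (q : ℝ) ^ k * (p * k) ≤ (q : ℝ) ^ k * (1 + (p : ℝ)) ^ k := by
      gcongr
      linarith
    _ = ((q : ℝ) * (1 + p)) ^ k := (mul_pow _ _ _).symm
    _ ≤ 1 := pow_le_one₀ (by positivity) (by nlinarith)
  exact mod_cast key

/-- The event that all `k` samples are far from the test point is measurable. -/
lemma measurableSet_forall_lt {X : Type*} [MeasurableSpace X]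
    {d : X × X → ℝ} (hd : Measurable d) (k : ℕ) (t : ℝ) :
    MeasurableSet {ω : (Fin k → X) × X | ∀ i, t < d (ω.1 i, ω.2)} := by
  rw [Set.ofPred_forall]
  exact MeasurableSet.iInter fun i => measurableSet_lt measurable_const (by fun_prop)

/-- The probability that all of `k` independent samples from `P` are farther than `t` from an
independent test point drawn from `Q` is at most `Δ_d(P,Q;t) / k`. -/
lemma measure_forall_lt_le_deltaGen_div {X : Type*} [MeasurableSpace X]
    (P Q : Measure X) [IsProbabilityMeasure P] [IsProbabilityMeasure Q]
    {d : X × X → ℝ} (hd : Measurable d) {k : ℕ} (hk : 1 ≤ k) (t : ℝ) :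
    ((Measure.pi fun _ : Fin k => P).prod Q)
      {ω : (Fin k → X) × X | ∀ i, t < d (ω.1 i, ω.2)} ≤ deltaGen d P Q t / k := by
  have hk0 : (k : ℝ≥0∞) ≠ 0 := by
    simpa using Nat.one_le_iff_ne_zero.mp hk
  rw [Measure.prod_apply_symm (measurableSet_forall_lt hd k t), deltaGen, div_eq_mul_inv,
    ← lintegral_mul_const' _ _ (ENNReal.inv_ne_top.mpr hk0)]
  refine lintegral_mono fun x => ?_
  have hball : MeasurableSet {z | d (z, x) ≤ t} :=
    measurableSet_le (by fun_prop) measurable_const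
  have hslice : (fun z : Fin k → X => (z, x)) ⁻¹' {ω | ∀ i, t < d (ω.1 i, ω.2)} =
      Set.univ.pi fun _ => {z | d (z, x) ≤ t}ᶜ := by
    ext z
    simp
  rw [hslice, Measure.pi_pi, Finset.prod_const, Finset.card_univ, Fintype.card_fin,
    ← div_eq_mul_inv]
  exact pow_le_inv_div_of_add_eq_one (prob_add_prob_compl hball) k

/-- For independent `Z_1,…,Z_m ~ P_X`, `W_1,…,W_n ~ Q_X` and
`X ~ Q_X` (i.e. under `P_X^m ⊗ Q_X^n ⊗ Q_X`), the probability that the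
minimum of `d(U, X)` over all `m + n` sample points `U` exceeds `t` is at most
`min{ Δ_d(P,Q;t)/m , Δ_d(Q,Q;t)/n }`. -/
theorem statement7 {X : Type*} [MeasurableSpace X]
    (PX QX : Measure X) [IsProbabilityMeasure PX] [IsProbabilityMeasure QX]
    (d : X × X → ℝ) (hd : Measurable d) (hd0 : ∀ p, 0 ≤ d p)
    (m n : ℕ) (hm : 1 ≤ m) (hn : 1 ≤ n) (t : ℝ) (ht : 0 < t) :
    ((Measure.pi fun _ : Fin m => PX).prod
        ((Measure.pi fun _ : Fin n => QX).prod QX))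
      {ω : (Fin m → X) × (Fin n → X) × X |
        (∀ i, t < d (ω.1 i, ω.2.2)) ∧ ∀ j, t < d (ω.2.1 j, ω.2.2)} ≤
      min (deltaGen d PX QX t / m) (deltaGen d QX QX t / n) := by
  refine le_min ?_ ?_
  · have hproj := (MeasurePreserving.id (Measure.pi fun _ : Fin m => PX)).prod
      (measurePreserving_snd (μ := Measure.pi fun _ : Fin n => QX) (ν := QX))
    refine le_trans (measure_mono fun ω hω => hω.1) (le_of_eq_of_le
      (hproj.measure_preimage (measurableSet_forall_lt hd m t).nullMeasurableSet)
      (measure_forall_lt_le_deltaGen_div PX QX hd hm t))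
  · have hproj := measurePreserving_snd (μ := Measure.pi fun _ : Fin m => PX)
      (ν := (Measure.pi fun _ : Fin n => QX).prod QX)
    refine le_trans (measure_mono fun ω hω => hω.2) (le_of_eq_of_le
      (hproj.measure_preimage (measurableSet_forall_lt hd n t).nullMeasurableSet)
      (measure_forall_lt_le_deltaGen_div QX QX hd hn t))
end
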